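/- For every n ∈ ℕ⁺, f(n, 2^{n−1} − 1) = 2ⁿ − n; that is, the maximum cardinality of a union-closed family 𝒮 ⊆ 2^{[n]} in which every element of [n] belongs to at most 2^{n−1} − 1 sets of 𝒮 equals 2ⁿ − n. -/

import Mathlib

open scoped Classical

/-- A family of subsets of `[n]` (modeled as `Fin n`) is union-closed if it is
closed under pairwise unions. -/
def UnionClosed {n : ℕ} (𝒮 : Finset (Finset (Fin n))) : Prop :=
  ∀ A ∈ 𝒮, ∀ B ∈ 𝒮, A ∪ B ∈ 𝒮

/-- `franklF n a` is the maximum cardinality of a union-closed family of subsets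
of `[n]` in which every element belongs to at most `a` sets. -/
noncomputable def franklF (n a : ℕ) : ℕ :=
  Finset.sup
    (Finset.univ.filter (fun 𝒮 : Finset (Finset (Fin n)) =>
      UnionClosed 𝒮 ∧ ∀ e : Fin n, (𝒮.filter (fun A => e ∈ A)).card ≤ a))
    Finset.card

theorem card_filter_mem_univ {n : ℕ} (e : Fin n) :
    ((Finset.univ : Finset (Finset (Fin n))).filter (fun A => e ∈ A)).card = 2 ^ (n - 1) := by
  have hcompl : ((Finset.univ : Finset (Finset (Fin n))).filter (fun A => e ∈ A)).card =
      ((Finset.univ : Finset (Finset (Fin n))).filter (fun A => ¬ e ∈ A)).card :=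
    Finset.card_bij' (fun A _ => Aᶜ) (fun A _ => Aᶜ) (by simp) (by simp) (by simp) (by simp)
  have hadd := Finset.card_filter_add_card_filter_not
    (s := (Finset.univ : Finset (Finset (Fin n)))) (fun A => e ∈ A)
  have hpow : 2 ^ n = 2 * 2 ^ (n - 1) := by
    rw [← pow_succ', Nat.sub_add_cancel e.pos]
  rw [Finset.card_univ, Fintype.card_finset, Fintype.card_fin] at hadd
  omega

theorem exists_notMem_of_card_filter_mem_le {n : ℕ} {𝒮 : Finset (Finset (Fin n))} {e : Fin n}
    (h : (𝒮.filter (fun A => e ∈ A)).card ≤ 2 ^ (n - 1) - 1) : ∃ A, A ∉ 𝒮 ∧ e ∈ A := by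
  by_contra! hall
  have hsub : Finset.univ.filter (fun A => e ∈ A) ⊆ 𝒮.filter (fun A => e ∈ A) := by
    intro A hA
    have he : e ∈ A := by simpa using hA
    exact Finset.mem_filter.2 ⟨by_contra fun hn => hall A hn he, he⟩
  have hle := Finset.card_le_card hsub
  rw [card_filter_mem_univ] at hle
  have hpos : 0 < 2 ^ (n - 1) := by positivity
  omega

/-- Sending each element to a smallest missing set containing it is injective. -/
theorem UnionClosed.le_card_compl {n : ℕ} {𝒮 : Finset (Finset (Fin n))} (hS : UnionClosed 𝒮)
    (h : ∀ e, ∃ A, A ∉ 𝒮 ∧ e ∈ A) : n ≤ 𝒮ᶜ.card := by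
  have hmin : ∀ e : Fin n, ∃ N, (N ∉ 𝒮 ∧ e ∈ N) ∧ ∀ A, A ∉ 𝒮 → e ∈ A → N.card ≤ A.card := by
    intro e
    obtain ⟨A, hA⟩ := h e
    obtain ⟨N, hN, hle⟩ := Finset.exists_min_image
      (Finset.univ.filter fun A => A ∉ 𝒮 ∧ e ∈ A) Finset.card ⟨A, by simpa using hA⟩
    exact ⟨N, by simpa using hN, fun B hB he => hle B (by simp [hB, he])⟩
  choose N hN hle using hmin
  have hinj : Function.Injective N := by
    intro e f hef
    by_contra hne
    have he : e ∈ N f := hef ▸ (hN e).2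
    have hf : f ∈ N f := (hN f).2
    have hcard : 1 < (N f).card := Finset.one_lt_card.2 ⟨e, he, f, hf, hne⟩
    have hsingle : {f} ∈ 𝒮 := by
      by_contra hn
      have := hle f {f} hn (Finset.mem_singleton_self f)
      rw [Finset.card_singleton] at this
      omega
    have herase : (N f).erase f ∈ 𝒮 := by
      by_contra hn
      have := hle e _ hn (Finset.mem_erase.2 ⟨hne, he⟩)
      rw [hef] at this
      exact absurd (Finset.card_erase_lt_of_mem hf) this.not_gt
    have hunion := hS _ hsingle _ herase
    rw [← Finset.insert_eq, Finset.insert_erase hf] at hunion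
    exact (hN f).1 hunion
  simpa using Finset.card_le_card_of_injOn (s := Finset.univ) (t := 𝒮ᶜ) N
    (fun e _ => by simpa using (hN e).1) hinj.injOn

theorem unionClosed_filter_card_ne_one (n : ℕ) :
    UnionClosed (Finset.univ.filter fun A : Finset (Fin n) => A.card ≠ 1) := by
  intro A hA B hB
  simp only [Finset.mem_filter, Finset.mem_univ, true_and] at *
  intro hAB
  have hA' := Finset.card_le_card (Finset.subset_union_left (s₁ := A) (s₂ := B))
  have hB' := Finset.card_le_card (Finset.subset_union_right (s₁ := A) (s₂ := B))
  have hle := Finset.card_union_le A B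
  omega

theorem card_filter_card_ne_one (n : ℕ) :
    (Finset.univ.filter fun A : Finset (Fin n) => A.card ≠ 1).card = 2 ^ n - n := by
  have hadd := Finset.card_filter_add_card_filter_not
    (s := (Finset.univ : Finset (Finset (Fin n)))) (fun A => A.card = 1)
  have hone : (Finset.univ.filter fun A : Finset (Fin n) => A.card = 1).card = n := by
    rw [Finset.univ_filter_card_eq]
    simp
  rw [Finset.card_univ, Fintype.card_finset, Fintype.card_fin, hone] at hadd
  simp only [ne_eq]
  omega

theorem card_filter_mem_filter_card_ne_one_le {n : ℕ} (e : Fin n) :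
    ((Finset.univ.filter fun A : Finset (Fin n) => A.card ≠ 1).filter (fun A => e ∈ A)).card ≤
      2 ^ (n - 1) - 1 := by
  rw [← card_filter_mem_univ e, ← Finset.card_erase_of_mem (a := {e}) (by simp)]
  refine Finset.card_le_card fun A hA => ?_
  simp only [Finset.mem_filter, Finset.mem_univ, true_and, Finset.mem_erase] at *
  exact ⟨fun h => hA.1 (by simp [h]), hA.2⟩

/-- `f(n, 2^(n-1) - 1) = 2^n - n`. -/
theorem franklF_pow_sub_one (n : ℕ) (hn : 0 < n) :
    franklF n (2 ^ (n - 1) - 1) = 2 ^ n - n := by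
  apply le_antisymm
  · refine Finset.sup_le fun 𝒮 h𝒮 => ?_
    obtain ⟨hS, hdeg⟩ := (Finset.mem_filter.1 h𝒮).2
    have hcompl := hS.le_card_compl fun e => exists_notMem_of_card_filter_mem_le (hdeg e)
    have hadd := Finset.card_add_card_compl 𝒮
    rw [Fintype.card_finset, Fintype.card_fin] at hadd
    omega
  · rw [← card_filter_card_ne_one n]
    exact Finset.le_sup (f := Finset.card) (Finset.mem_filter.2 ⟨Finset.mem_univ _,
      unionClosed_filter_card_ne_one n, card_filter_mem_filter_card_ne_one_le⟩)
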